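/- Consider the causal model M = ({X,Y}, E₀, f₀, X→Y) where X and Y each take n values, E₀ is independent of X and takes θ values, Y = f₀(X,E₀), and f₀ is a generic function. If the distribution of X is sampled uniformly from the (n−1)-dimensional probability simplex and the distribution of E₀ is sampled uniformly and independently from the (θ−1)-dimensional probability simplex, then with probability 1 the following holds: every finite discrete random variable Ẽ independent of Y for which there is a deterministic function g with X = g(Y,Ẽ) (inducing the same joint distribution of (X,Y)) has support of cardinality at least n(n−1). -/

import Mathlib

open MeasureTheory

/-- `(pE, f)` is a causal model in direction `X → Y` for the joint distribution `p`:
`pE` is the distribution of a finite exogenous variable `E` independent of `X`,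
and `Y = f(X, E)`, so that `p x y = P(X = x) · P(f(x, E) = y)`. -/
def IsCausalModel {α β γ : Type*} [Fintype α] [Fintype β] [Fintype γ] [DecidableEq β]
    (p : α → β → ℝ) (pE : γ → ℝ) (f : α → γ → β) : Prop :=
  (∀ e, 0 ≤ pE e) ∧ (∑ e, pE e = 1) ∧
    ∀ x y, p x y = (∑ y', p x y') * ∑ e, if f x e = y then pE e else 0

/-- A function `f` with `Y = f(X,E)` is generic if for every `x₁ ≠ x₂` and every `y` the
inverse maps `f_{x₁}⁻¹(y) = {e : f x₁ e = y}` and `f_{x₂}⁻¹(y)` differ, and every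
`f_x⁻¹(y)` is nonempty. -/
def Generic {n θ m : ℕ} (f : Fin n → Fin θ → Fin m) : Prop :=
  (∀ x₁ x₂ y, x₁ ≠ x₂ → {e | f x₁ e = y} ≠ {e | f x₂ e = y}) ∧
  (∀ x y, ∃ e, f x e = y)

/-- The joint distribution of `(X, Y)` induced by `X ∼ pX`, `E ∼ pE` with `E ⟂ X`,
and `Y = f(X, E)`. -/
noncomputable def jointOf {n θ m : ℕ} (pX : Fin n → ℝ) (pE : Fin θ → ℝ)
    (f : Fin n → Fin θ → Fin m) (x : Fin n) (y : Fin m) : ℝ :=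
  pX x * ∑ e, if f x e = y then pE e else 0

/-- The uniform probability measure on the `(k-1)`-dimensional probability simplex:
the `(k-1)`-dimensional Hausdorff measure restricted to the simplex, normalized. -/
noncomputable def uniformSimplex (k : ℕ) : Measure (Fin k → ℝ) :=
  (μH[(k : ℝ) - 1] (stdSimplex ℝ (Fin k)))⁻¹ •
    (μH[(k : ℝ) - 1]).restrict (stdSimplex ℝ (Fin k))

/-- A real-analytic function on `ℝᵏ` that does not vanish identically is almost everywhere
nonzero. -/
theorem ae_ne_zero_of_analyticOnNhd {k : ℕ} {f : (Fin k → ℝ) → ℝ}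
    (hf : AnalyticOnNhd ℝ f Set.univ) {t₀ : Fin k → ℝ} (h₀ : f t₀ ≠ 0) :
    ∀ᵐ t, f t ≠ 0 := by
  induction k with
  | zero =>
    refine Filter.Eventually.of_forall fun t => ?_
    rwa [Subsingleton.elim t t₀]
  | succ k ih =>
    have hcons : AnalyticOnNhd ℝ (fun p : ℝ × (Fin k → ℝ) => f (Fin.cons p.1 p.2)) Set.univ := by
      intro p _
      have hc : AnalyticAt ℝ (fun p : ℝ × (Fin k → ℝ) => (Fin.cons p.1 p.2 : Fin (k + 1) → ℝ)) p := by
        rw [analyticAt_pi_iff]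
        intro i
        refine Fin.cases ?_ (fun j => ?_) i
        · simpa using analyticAt_fst
        · simp only [Fin.cons_succ]
          exact ((ContinuousLinearMap.proj (R := ℝ) (φ := fun _ : Fin k => ℝ) j).comp
            (ContinuousLinearMap.snd ℝ ℝ (Fin k → ℝ))).analyticAt p
      exact AnalyticAt.fun_comp (hf _ trivial) hc
    have hmeas : MeasurableSet {t : Fin (k + 1) → ℝ | ¬ f t ≠ 0} := by
      have : Continuous f := continuous_iff_continuousAt.2 fun t => (hf t trivial).continuousAt
      simp only [not_not]
      exact (isClosed_eq this continuous_const).measurableSet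
    have hfst : ∀ᵐ a : ℝ, f (Fin.cons a (Fin.tail t₀)) ≠ 0 := by
      have h1 : AnalyticOnNhd ℝ (fun a : ℝ => f (Fin.cons a (Fin.tail t₀))) Set.univ := fun a _ =>
        AnalyticAt.fun_comp (f := fun a : ℝ => (a, Fin.tail t₀)) (hcons _ trivial) (by fun_prop)
      rcases h1.eqOn_zero_or_eventually_ne_zero_of_preconnected isPreconnected_univ with h | h
      · refine absurd (h (Set.mem_univ (t₀ 0))) ?_
        simpa using h₀
      · have := ae_restrict_le_codiscreteWithin (μ := (volume : Measure ℝ)) MeasurableSet.univ h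
        rwa [Measure.restrict_univ] at this
    have hmp := (volume_preserving_piFinSuccAbove (fun _ : Fin (k + 1) => ℝ) 0).symm
    have hprod : ∀ᵐ p : ℝ × (Fin k → ℝ), f (Fin.cons p.1 p.2) ≠ 0 := by
      refine Measure.measure_prod_null_of_ae_null ?_ ?_
      · have hc : Continuous fun p : ℝ × (Fin k → ℝ) => f (Fin.cons p.1 p.2) :=
          continuous_iff_continuousAt.2 fun t => (hcons t trivial).continuousAt
        exact ((isClosed_eq hc continuous_const).isOpen_compl.measurableSet).compl
      · filter_upwards [hfst] with a ha
        exact ih (f := fun t => f (Fin.cons a t)) (t₀ := Fin.tail t₀) (fun t _ =>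
          AnalyticAt.fun_comp (f := fun t : Fin k → ℝ => (a, t)) (hcons _ trivial) (by fun_prop)) ha
    rw [ae_iff, ← hmp.measure_preimage hmeas.nullMeasurableSet]
    simpa [ae_iff, Set.preimage, MeasurableEquiv.piFinSuccAbove, Fin.insertNthEquiv] using hprod

/-- A real-analytic function that does not vanish identically on the affine hyperplane spanned by
the simplex is nonzero almost everywhere on the simplex. -/
theorem ae_uniformSimplex_ne_zero {k : ℕ} {f : (Fin k → ℝ) → ℝ}
    (hf : AnalyticOnNhd ℝ f Set.univ) {a₀ : Fin k → ℝ} (ha₀ : ∑ i, a₀ i = 1) (h₀ : f a₀ ≠ 0) :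
    ∀ᵐ a ∂(uniformSimplex k), f a ≠ 0 := by
  obtain _ | d := k
  · simp at ha₀
  let φ : (Fin d → ℝ) → (Fin (d + 1) → ℝ) := fun t => Fin.cons (1 - ∑ i, t i) t
  have hφ : LipschitzWith (d + 1) φ := by
    refine LipschitzWith.of_dist_le_mul fun s t => ?_
    have hd : 0 ≤ dist s t := dist_nonneg
    push_cast
    refine (dist_pi_le_iff (by positivity)).2 fun i => ?_
    refine Fin.cases ?_ (fun j => ?_) i
    · have : |∑ i, t i - ∑ i, s i| ≤ d * dist s t := by
        rw [← Finset.sum_sub_distrib]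
        refine (Finset.abs_sum_le_sum_abs _ _).trans ?_
        refine (Finset.sum_le_card_nsmul _ _ (dist s t) fun i _ => ?_).trans (by simp)
        rw [← Real.dist_eq, dist_comm]
        exact dist_le_pi_dist s t i
      simp only [φ, Fin.cons_zero, Real.dist_eq]
      rw [show 1 - ∑ i, s i - (1 - ∑ i, t i) = ∑ i, t i - ∑ i, s i by ring]
      linarith
    · have := dist_le_pi_dist s t j
      simp only [φ, Fin.cons_succ]
      nlinarith [mul_nonneg (Nat.cast_nonneg (α := ℝ) d) hd]
  have hφtail : ∀ a : Fin (d + 1) → ℝ, ∑ i, a i = 1 → φ (Fin.tail a) = a := by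
    intro a ha
    rw [Fin.sum_univ_succ] at ha
    conv_rhs => rw [← Fin.cons_self_tail a]
    simp only [φ, Fin.tail]
    congr 1
    linarith
  have hφan : AnalyticOnNhd ℝ φ Set.univ := by
    intro t _
    rw [analyticAt_pi_iff]
    intro i
    refine Fin.cases ?_ (fun j => ?_) i
    · simp only [Fin.cons_zero]
      exact analyticAt_const.sub (Finset.analyticAt_fun_sum _ fun i _ =>
        (ContinuousLinearMap.proj (R := ℝ) (φ := fun _ : Fin d => ℝ) i).analyticAt t)
    · simp only [Fin.cons_succ]
      exact (ContinuousLinearMap.proj (R := ℝ) (φ := fun _ : Fin d => ℝ) j).analyticAt t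
  have hnull : ∀ᵐ t, f (φ t) ≠ 0 :=
    ae_ne_zero_of_analyticOnNhd (f := fun t => f (φ t)) (t₀ := Fin.tail a₀)
      (fun t _ => AnalyticAt.fun_comp (hf _ trivial) (hφan t trivial)) (by rwa [hφtail a₀ ha₀])
  have himg : μH[((d + 1 : ℕ) : ℝ) - 1] (φ '' {t | f (φ t) = 0}) = 0 := by
    have hle := hφ.hausdorffMeasure_image_le (d := (d : ℝ)) (Nat.cast_nonneg d) {t | f (φ t) = 0}
    have hvol : (μH[(d : ℝ)] : Measure (Fin d → ℝ)) = volume := by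
      simpa using hausdorffMeasure_pi_real (ι := Fin d)
    have hz : (volume : Measure (Fin d → ℝ)) {t | f (φ t) = 0} = 0 := by
      simpa [ae_iff] using hnull
    rw [hvol, hz, mul_zero] at hle
    simpa using hle
  refine Measure.ae_smul_measure ?_ _
  rw [ae_restrict_iff' (isClosed_stdSimplex ..).measurableSet, ae_iff]
  refine measure_mono_null (fun a ha => ?_) himg
  simp only [ne_eq, Set.mem_ofPred_eq, not_forall, not_not, exists_prop] at ha
  exact ⟨Fin.tail a, by simpa [hφtail a ha.1.2] using ha.2, hφtail a ha.1.2⟩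

/-- The mass `∑_{i : f i = y} e i` that the weights `e` give to the fibre of `f` over `y`. -/
def fiberMass {θ n : ℕ} (f : Fin θ → Fin n) (e : Fin θ → ℝ) (y : Fin n) : ℝ :=
  ∑ i, if f i = y then e i else 0

theorem fiberMass_mul {θ n : ℕ} (f : Fin θ → Fin n) (c : ℝ) (e : Fin θ → ℝ) (y : Fin n) :
    fiberMass f (fun i => c * e i) y = c * fiberMass f e y := by
  simp [fiberMass, Finset.mul_sum]

theorem le_fiberMass {θ n : ℕ} {f : Fin θ → Fin n} {e : Fin θ → ℝ} (he : ∀ i, 0 ≤ e i)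
    {y : Fin n} {i : Fin θ} (hi : f i = y) : e i ≤ fiberMass f e y := by
  have := Finset.single_le_sum (f := fun i => if f i = y then e i else 0)
    (fun j _ => by split_ifs <;> simp [he]) (Finset.mem_univ i)
  simpa [fiberMass, hi] using this

theorem fiberMass_le {θ n : ℕ} {f : Fin θ → Fin n} {e : Fin θ → ℝ} {y : Fin n}
    (he : ∀ i, f i = y → e i ≤ 1) : fiberMass f e y ≤ θ := by
  refine (Finset.sum_le_card_nsmul _ _ 1 fun i _ => ?_).trans (by simp)
  split_ifs with h
  · exact he i h
  · exact zero_le_one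

/-- If the fibre of `f₁` over `y₀` contains a point outside the fibre of `f₂` over `y₀`, then
putting almost all the mass at this point separates the fibre masses of `f₁` and `f₂`. -/
theorem exists_separating_weights {θ n : ℕ} {f₁ f₂ : Fin θ → Fin n}
    (h₁ : Function.Surjective f₁) (h₂ : Function.Surjective f₂) {y₀ : Fin n} {i₀ : Fin θ}
    (hi₁ : f₁ i₀ = y₀) (hi₂ : f₂ i₀ ≠ y₀) :
    ∃ e : Fin θ → ℝ, ∑ i, e i = 1 ∧ 0 < fiberMass f₁ e y₀ ∧ 0 < fiberMass f₂ e y₀ ∧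
      fiberMass f₂ e y₀ < fiberMass f₁ e y₀ ∧
      ∀ y, y ≠ y₀ → fiberMass f₁ e y * fiberMass f₂ e y₀ < fiberMass f₁ e y₀ * fiberMass f₂ e y := by
  have hθ : (1 : ℝ) ≤ θ := by exact_mod_cast i₀.pos
  let e : Fin θ → ℝ := fun i => if i = i₀ then (θ : ℝ) ^ 2 + 1 else 1
  have he1 : ∀ i, 1 ≤ e i := fun i => by
    simp only [e]; split_ifs <;> nlinarith
  have he0 : ∀ i, 0 ≤ e i := fun i => zero_le_one.trans (he1 i)
  have hone : ∀ f : Fin θ → Fin n, Function.Surjective f → ∀ y, 1 ≤ fiberMass f e y := by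
    intro f hf y
    obtain ⟨i, hi⟩ := hf y
    exact (he1 i).trans (le_fiberMass he0 hi)
  have hbig : (θ : ℝ) ^ 2 + 1 ≤ fiberMass f₁ e y₀ := by
    simpa [e] using le_fiberMass he0 hi₁
  have hsmall₂ : fiberMass f₂ e y₀ ≤ θ := fiberMass_le fun i hi => by
    have : i ≠ i₀ := by rintro rfl; exact hi₂ hi
    simp [e, this]
  have hsmall₁ : ∀ y, y ≠ y₀ → fiberMass f₁ e y ≤ θ := fun y hy => fiberMass_le fun i hi => by
    have : i ≠ i₀ := by rintro rfl; exact hy (hi.symm.trans hi₁)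
    simp [e, this]
  have hS : 0 < ∑ i, e i :=
    Finset.sum_pos (fun i _ => zero_lt_one.trans_le (he1 i)) ⟨i₀, Finset.mem_univ _⟩
  have hc : 0 < (∑ i, e i)⁻¹ := inv_pos.2 hS
  have hb := hone f₂ h₂ y₀
  refine ⟨fun i => (∑ i, e i)⁻¹ * e i, ?_, ?_⟩
  · rw [← Finset.mul_sum, inv_mul_cancel₀ hS.ne']
  simp only [fiberMass_mul]
  refine ⟨mul_pos hc (by nlinarith), mul_pos hc (by linarith),
    mul_lt_mul_of_pos_left (by nlinarith) hc, fun y hy => ?_⟩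
  have key : fiberMass f₁ e y * fiberMass f₂ e y₀ < fiberMass f₁ e y₀ * fiberMass f₂ e y := by
    have h1 := hsmall₁ y hy
    have h2 := hone f₁ h₁ y
    have h3 := hone f₂ h₂ y
    have h4 : 0 ≤ fiberMass f₁ e y₀ := zero_le_one.trans (hone f₁ h₁ y₀)
    calc fiberMass f₁ e y * fiberMass f₂ e y₀ ≤ θ * θ := by gcongr
      _ < ((θ : ℝ) ^ 2 + 1) * 1 := by nlinarith
      _ ≤ _ := by gcongr
  rw [mul_mul_mul_comm, mul_mul_mul_comm _ _ _ (fiberMass f₂ e y)]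
  exact mul_lt_mul_of_pos_left key (mul_pos hc hc)

/-- The numerator, after clearing the denominators `P(Y = y)`, of the linear combination
`∑_{x,y} w x y · P(X = x | Y = y)`. -/
noncomputable def relationNumerator {n θ : ℕ} (w : Fin n → Fin n → ℝ)
    (f : Fin n → Fin θ → Fin n) (a : Fin n → ℝ) (e : Fin θ → ℝ) : ℝ :=
  ∑ y, (∑ x, w x y * (a x * fiberMass (f x) e y)) *
    ∏ y' ∈ Finset.univ.erase y, ∑ x, a x * fiberMass (f x) e y'

theorem analyticAt_relationNumerator {n θ : ℕ} (w : Fin n → Fin n → ℝ)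
    (f : Fin n → Fin θ → Fin n) (p : (Fin n → ℝ) × (Fin θ → ℝ)) :
    AnalyticAt ℝ (fun p : (Fin n → ℝ) × (Fin θ → ℝ) => relationNumerator w f p.1 p.2) p := by
  have ha : ∀ x, AnalyticAt ℝ (fun p : (Fin n → ℝ) × (Fin θ → ℝ) => p.1 x) p := fun x =>
    ((ContinuousLinearMap.proj (R := ℝ) (φ := fun _ : Fin n => ℝ) x).comp
      (ContinuousLinearMap.fst ℝ (Fin n → ℝ) (Fin θ → ℝ))).analyticAt p
  have hq : ∀ x y, AnalyticAt ℝ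
      (fun p : (Fin n → ℝ) × (Fin θ → ℝ) => fiberMass (f x) p.2 y) p := by
    intro x y
    refine Finset.analyticAt_fun_sum _ fun i _ => ?_
    split_ifs
    · exact ((ContinuousLinearMap.proj (R := ℝ) (φ := fun _ : Fin θ => ℝ) i).comp
        (ContinuousLinearMap.snd ℝ (Fin n → ℝ) (Fin θ → ℝ))).analyticAt p
    · exact analyticAt_const
  refine Finset.analyticAt_fun_sum _ fun y _ => AnalyticAt.mul ?_ ?_
  · exact Finset.analyticAt_fun_sum _ fun x _ => analyticAt_const.mul ((ha x).mul (hq x y))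
  · exact Finset.analyticAt_fun_prod _ fun y' _ =>
      Finset.analyticAt_fun_sum _ fun x _ => (ha x).mul (hq x y')

/-- The linear form on `ℝⁿ` with coefficients `c`. -/
noncomputable def linForm {n : ℕ} (c : Fin n → ℝ) : Module.Dual ℝ (Fin n → ℝ) :=
  ∑ x, c x • LinearMap.proj x

theorem linForm_apply {n : ℕ} (c a : Fin n → ℝ) : linForm c a = ∑ x, a x * c x := by
  simp [linForm, mul_comm]

theorem linForm_sub_single {n : ℕ} (c : Fin n → ℝ) (x x' : Fin n) (s t : ℝ) :
    linForm c (Pi.single x s - Pi.single x' t) = s * c x - t * c x' := by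
  rw [map_sub, linForm_apply, linForm_apply]
  simp [Pi.single_apply]

theorem exists_relationNumerator_ne_zero {n θ : ℕ} {f : Fin n → Fin θ → Fin n} (hf : Generic f)
    {w : Fin n → Fin n → ℝ} {x₀ x₁ y₀ : Fin n} (hw₀ : w x₀ y₀ = 0) (hw₁ : w x₁ y₀ ≠ 0) :
    ∃ (a : Fin n → ℝ) (e : Fin θ → ℝ), ∑ x, a x = 1 ∧ ∑ i, e i = 1 ∧
      relationNumerator w f a e ≠ 0 := by
  have hx : x₀ ≠ x₁ := by rintro rfl; exact hw₁ hw₀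
  obtain ⟨e, he, hq₀, hq₁, hne, hcross⟩ : ∃ e : Fin θ → ℝ, ∑ i, e i = 1 ∧
      fiberMass (f x₀) e y₀ ≠ 0 ∧ fiberMass (f x₁) e y₀ ≠ 0 ∧
      fiberMass (f x₀) e y₀ ≠ fiberMass (f x₁) e y₀ ∧
      ∀ y, y ≠ y₀ → fiberMass (f x₁) e y₀ * fiberMass (f x₀) e y ≠
        fiberMass (f x₀) e y₀ * fiberMass (f x₁) e y := by
    obtain ⟨i, hi⟩ : ∃ i, ¬ (f x₀ i = y₀ ↔ f x₁ i = y₀) := by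
      by_contra! h
      exact hf.1 x₀ x₁ y₀ hx (Set.ext h)
    by_cases h : f x₀ i = y₀
    · obtain ⟨e, he, h0, h1, hlt, hc⟩ := exists_separating_weights (hf.2 x₀) (hf.2 x₁) h
        (by tauto)
      exact ⟨e, he, h0.ne', h1.ne', hlt.ne', fun y hy => by rw [mul_comm]; exact (hc y hy).ne⟩
    · obtain ⟨e, he, h0, h1, hlt, hc⟩ := exists_separating_weights (hf.2 x₁) (hf.2 x₀)
        (i₀ := i) (y₀ := y₀) (by tauto) h
      refine ⟨e, he, h1.ne', h0.ne', hlt.ne, fun y hy => ?_⟩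
      rw [mul_comm (fiberMass (f x₀) e y₀)]
      exact (hc y hy).ne'
  set q : Fin n → Fin n → ℝ := fun x y => fiberMass (f x) e y with hq
  let c : Option (Fin n) → Fin n → ℝ := fun o => o.elim (fun _ => 1) fun y x =>
    if y = y₀ then w x y₀ * q x y₀ else q x y
  obtain ⟨a, hker, ha⟩ := Module.Dual.exists_forall_mem_ne_zero_of_forall_exists
    (LinearMap.ker (linForm fun x => q x y₀)) (fun o => linForm (c o)) (by
      intro o
      refine ⟨Pi.single x₀ (q x₁ y₀) - Pi.single x₁ (q x₀ y₀), ?_, ?_⟩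
      · rw [LinearMap.mem_ker, linForm_sub_single]; ring
      rw [linForm_sub_single]
      rcases o with _ | y
      · simpa [c, sub_eq_zero] using hne.symm
      · by_cases hy : y = y₀
        · simpa [c, hy, hw₀, hq] using ⟨hq₀, hw₁, hq₁⟩
        · simpa [c, hy, sub_eq_zero] using hcross y hy)
  have hsum : ∑ x, a x ≠ 0 := by simpa [linForm_apply, c] using ha none
  have hker' : ∑ x, a x * q x y₀ = 0 := by simpa [linForm_apply] using hker
  have hwform : ∑ x, w x y₀ * (a x * q x y₀) ≠ 0 := by
    have := ha (some y₀)
    simpa [linForm_apply, c, mul_left_comm] using this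
  have hform : ∀ y, y ≠ y₀ → ∑ x, a x * q x y ≠ 0 := fun y hy => by
    simpa [linForm_apply, c, hy] using ha (some y)
  set r := (∑ x, a x)⁻¹ with hr
  have hr0 : r ≠ 0 := inv_ne_zero hsum
  refine ⟨fun x => r * a x, e, by rw [← Finset.mul_sum, inv_mul_cancel₀ hsum], he, ?_⟩
  have hs : ∀ y, ∑ x, r * a x * fiberMass (f x) e y = r * ∑ x, a x * q x y := fun y => by
    simp [Finset.mul_sum, mul_assoc, hq]
  have hw : ∑ x, w x y₀ * (r * a x * fiberMass (f x) e y₀) =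
      r * ∑ x, w x y₀ * (a x * q x y₀) := by
    rw [Finset.mul_sum]
    exact Finset.sum_congr rfl fun x _ => by simp only [hq]; ring
  rw [relationNumerator, Finset.sum_eq_single y₀]
  · rw [hw]
    refine mul_ne_zero (mul_ne_zero hr0 hwform) (Finset.prod_ne_zero_iff.2 fun y hy => ?_)
    rw [hs]
    exact mul_ne_zero hr0 (hform y (Finset.ne_of_mem_erase hy))
  · intro y _ hy
    refine mul_eq_zero_of_right _ (Finset.prod_eq_zero
      (Finset.mem_erase.2 ⟨hy.symm, Finset.mem_univ y₀⟩) ?_)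
    rw [hs, hker', mul_zero]
  · simp

theorem ae_relationNumerator_ne_zero {n θ : ℕ} {f : Fin n → Fin θ → Fin n} (hf : Generic f)
    {w : Fin n → Fin n → ℝ} {x₀ : Fin n} (hw₀ : ∀ y, w x₀ y = 0) (hw : w ≠ 0) :
    ∀ᵐ p ∂((uniformSimplex n).prod (uniformSimplex θ)), relationNumerator w f p.1 p.2 ≠ 0 := by
  obtain ⟨x₁, hx₁⟩ := Function.ne_iff.1 hw
  obtain ⟨y₀, hy₀⟩ := Function.ne_iff.1 hx₁
  obtain ⟨a, e, ha, he, hne⟩ := exists_relationNumerator_ne_zero hf (hw₀ y₀) hy₀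
  refine Measure.measure_prod_null_of_ae_null ?_ ?_
  · have hc : Continuous fun p : (Fin n → ℝ) × (Fin θ → ℝ) => relationNumerator w f p.1 p.2 :=
      continuous_iff_continuousAt.2 fun p => (analyticAt_relationNumerator w f p).continuousAt
    exact (isClosed_eq hc continuous_const).isOpen_compl.measurableSet.compl
  · have h₁ : ∀ᵐ a ∂(uniformSimplex n), relationNumerator w f a e ≠ 0 :=
      ae_uniformSimplex_ne_zero (f := fun a => relationNumerator w f a e) (fun a _ =>
        AnalyticAt.fun_comp (f := fun a : Fin n → ℝ => (a, e))
          (analyticAt_relationNumerator w f _) (by fun_prop)) ha hne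
    filter_upwards [h₁] with a ha
    exact ae_uniformSimplex_ne_zero (f := fun e => relationNumerator w f a e) (fun e _ =>
      AnalyticAt.fun_comp (f := fun e : Fin θ → ℝ => (a, e))
        (analyticAt_relationNumerator w f _) (by fun_prop)) he ha

/-- Fewer than `n(n-1)` functions `y ↦ h y` satisfy a common nontrivial linear relation that does
not involve the state `x₀`. -/
theorem exists_common_relation {n : ℕ} (x₀ : Fin n) (T : Finset (Fin n → Fin n))
    (hT : T.card < n * (n - 1)) :
    ∃ w : Fin n → Fin n → ℝ, w ≠ 0 ∧ (∀ y, w x₀ y = 0) ∧ ∀ h ∈ T, ∑ y, w (h y) y = 0 := by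
  let ext : ({x // x ≠ x₀} × Fin n → ℝ) →ₗ[ℝ] (Fin n → Fin n → ℝ) :=
    { toFun := fun v x y => if hx : x ≠ x₀ then v (⟨x, hx⟩, y) else 0
      map_add' := fun u v => by ext x y; by_cases hx : x = x₀ <;> simp [hx]
      map_smul' := fun r v => by ext x y; by_cases hx : x = x₀ <;> simp [hx] }
  let L : ({x // x ≠ x₀} × Fin n → ℝ) →ₗ[ℝ] (T → ℝ) :=
    { toFun := fun v h => ∑ y, ext v (h.1 y) y
      map_add' := fun u v => by ext h; simp [Finset.sum_add_distrib]
      map_smul' := fun r v => by ext h; simp [Finset.mul_sum] }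
  have hL : LinearMap.ker L ≠ ⊥ := L.ker_ne_bot_of_finrank_lt (by
    simpa [Fintype.card_subtype_compl, mul_comm] using hT)
  obtain ⟨v, hv, hv0⟩ := Submodule.exists_mem_ne_zero_of_ne_bot hL
  refine ⟨ext v, fun h => hv0 ?_, fun y => by simp [ext], fun h hh => ?_⟩
  · ext ⟨x, y⟩
    simpa [ext, x.2] using congrFun (congrFun h x.1) y
  · exact congrFun (LinearMap.mem_ker.1 hv) ⟨h, hh⟩

/-- If every function `g(·, e)` with `e` in the support satisfies the linear relation `w`, then so
do the conditional distributions of `X` given `Y`. -/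
theorem relationNumerator_eq_zero {n θ m : ℕ} {f : Fin n → Fin θ → Fin n} {a : Fin n → ℝ}
    {e : Fin θ → ℝ} {pE : Fin m → ℝ} {g : Fin n → Fin m → Fin n}
    (h : IsCausalModel (fun y x => jointOf a e f x y) pE g) {w : Fin n → Fin n → ℝ}
    (hw : ∀ i, pE i ≠ 0 → ∑ y, w (g y i) y = 0) : relationNumerator w f a e = 0 := by
  obtain ⟨-, -, hp⟩ := h
  have hterm : ∀ y, (∑ x, w x y * (a x * fiberMass (f x) e y)) *
      (∏ y' ∈ Finset.univ.erase y, ∑ x, a x * fiberMass (f x) e y') =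
      (∏ y', ∑ x, a x * fiberMass (f x) e y') * ∑ i, pE i * w (g y i) y := by
    intro y
    rw [← Finset.mul_prod_erase _ _ (Finset.mem_univ y)]
    have : ∑ x, w x y * (a x * fiberMass (f x) e y) =
        (∑ x, a x * fiberMass (f x) e y) * ∑ i, pE i * w (g y i) y := by
      calc ∑ x, w x y * (a x * fiberMass (f x) e y)
          = ∑ x, w x y * ((∑ x, a x * fiberMass (f x) e y) *
              ∑ i, if g y i = x then pE i else 0) :=
            Finset.sum_congr rfl fun x _ => congrArg _ (hp y x)
        _ = (∑ x, a x * fiberMass (f x) e y) *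
              ∑ x, ∑ i, if g y i = x then pE i * w x y else 0 := by
            rw [Finset.mul_sum]
            refine Finset.sum_congr rfl fun x _ => ?_
            rw [mul_left_comm, Finset.mul_sum]
            congr 1
            exact Finset.sum_congr rfl fun i _ => by split_ifs <;> ring
        _ = _ := by
            rw [Finset.sum_comm]
            simp
    rw [this]
    ring
  rw [relationNumerator, Finset.sum_congr rfl fun y _ => hterm y, ← Finset.mul_sum,
    Finset.sum_comm]
  refine mul_eq_zero_of_right _ (Finset.sum_eq_zero fun i _ => ?_)
  rw [← Finset.mul_sum]
  by_cases hi : pE i = 0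
  · simp [hi]
  · simp [hw i hi]

/-- **Identifiability for `H₀` entropy (Theorem 1).**
Consider the causal model `X → Y` with `Y = f₀(X, E₀)`, where `X, Y` have `n` states,
`E₀ ⟂ X` has `θ` states and `f₀` is generic.  If the distributions of `X` and `E₀` are
drawn uniformly and independently from the `(n-1)`- and `(θ-1)`-dimensional probability
simplices, then with probability `1` every finite exogenous variable `Ẽ ⟂ Y` satisfying
`X = g(Y, Ẽ)` for a deterministic `g` (and inducing the same joint distribution of
`(X, Y)`) has support of cardinality at least `n(n-1)`. -/
theorem reverse_exogenous_card_ge_ae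
    (n θ : ℕ) (hn : 0 < n) (hθ : 0 < θ)
    (f₀ : Fin n → Fin θ → Fin n) (hf₀ : Generic f₀) :
    ∀ᵐ w ∂((uniformSimplex n).prod (uniformSimplex θ)),
      ∀ (m : ℕ) (pE' : Fin m → ℝ) (g : Fin n → Fin m → Fin n),
        IsCausalModel (fun y x => jointOf w.1 w.2 f₀ x y) pE' g →
        n * (n - 1) ≤ (Finset.univ.filter fun e => pE' e ≠ 0).card := by
  classical
  let x₀ : Fin n := ⟨0, hn⟩
  have key : ∀ᵐ p ∂((uniformSimplex n).prod (uniformSimplex θ)),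
      ∀ T : Finset (Fin n → Fin n), T.card < n * (n - 1) →
        ∃ w : Fin n → Fin n → ℝ, (∀ h ∈ T, ∑ y, w (h y) y = 0) ∧
          relationNumerator w f₀ p.1 p.2 ≠ 0 := by
    rw [ae_all_iff]
    intro T
    by_cases hT : T.card < n * (n - 1)
    · obtain ⟨w, hw, hw₀, hwT⟩ := exists_common_relation x₀ T hT
      filter_upwards [ae_relationNumerator_ne_zero hf₀ hw₀ hw] with p hp _
      exact ⟨w, hwT, hp⟩
    · exact Filter.Eventually.of_forall fun p h => absurd h hT
  filter_upwards [key] with p hp m pE' g hg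
  by_contra! hlt
  obtain ⟨w, hwT, hne⟩ := hp
    ((Finset.univ.filter fun e => pE' e ≠ 0).image fun i y => g y i)
    (Finset.card_image_le.trans_lt hlt)
  refine hne (relationNumerator_eq_zero hg fun i hi => ?_)
  exact hwT _ (Finset.mem_image_of_mem (fun i y => g y i) (by simpa using hi))
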